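/- Let n ≥ 1, p ∈ [1,∞), and let u : ℝⁿ → ℝ be a smooth function with compact support. Then for every y ∈ ℝⁿ and every t > 0, min(1, t) · ‖ u(·+y) − u ‖_{L^p(ℝⁿ)} ≤ 2 · inf { ‖u − v‖_{L^p(ℝⁿ)} + (t|y|/2) ‖∇v‖_{L^p(ℝⁿ)} : v smooth with compact support }. -/

import Mathlib

open MeasureTheory

lemma aux_pointwise {E : Type*} [NormedAddCommGroup E] [InnerProductSpace ℝ E] [CompleteSpace E]
    (v : E → ℝ) (hv : ContDiff ℝ (⊤ : ℕ∞) v) (x y : E) :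
    ‖v (x + y) - v x‖ₑ ≤ ‖y‖ₑ * ∫⁻ s in Set.Ioc (0:ℝ) 1, ‖gradient v (x + s • y)‖ₑ := by
  have hd : ∀ s : ℝ, HasDerivAt (fun s : ℝ => v (x + s • y)) (fderiv ℝ v (x + s • y) y) s := by
    intro s
    have h1 : HasFDerivAt v (fderiv ℝ v (x + s • y)) (x + s • y) :=
      ((hv.differentiable (by simp)) _).hasFDerivAt
    have h2 : HasDerivAt (fun s : ℝ => x + s • y) y s := by
      simpa using ((hasDerivAt_id s).smul_const y).const_add x
    exact h1.comp_hasDerivAt s h2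
  have hc : Continuous (fun s : ℝ => fderiv ℝ v (x + s • y) y) := by
    have := hv.continuous_fderiv (by simp)
    fun_prop
  have h := intervalIntegral.integral_eq_sub_of_hasDerivAt (a := 0) (b := 1)
    (fun s _ => hd s) (hc.intervalIntegrable 0 1)
  simp only [one_smul, zero_smul, add_zero] at h
  rw [← h, intervalIntegral.integral_of_le zero_le_one]
  refine (enorm_integral_le_lintegral_enorm _).trans ?_
  rw [← lintegral_const_mul' _ _ enorm_ne_top]
  refine lintegral_mono fun s => ?_
  have : ‖gradient v (x + s • y)‖ₑ = ‖fderiv ℝ v (x + s • y)‖ₑ := by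
    simp [gradient, ← ofReal_norm]
  dsimp only
  rw [this, mul_comm]
  exact ContinuousLinearMap.le_opENorm _ _

lemma aux_jensen (p : ℝ) (hp : 1 ≤ p) (f : ℝ → ENNReal) (hf : Measurable f) :
    (∫⁻ s in Set.Ioc (0:ℝ) 1, f s) ^ p ≤ ∫⁻ s in Set.Ioc (0:ℝ) 1, f s ^ p := by
  have : IsProbabilityMeasure (volume.restrict (Set.Ioc (0:ℝ) 1)) := ⟨by simp⟩
  have h := eLpNorm'_le_eLpNorm'_of_exponent_le (μ := volume.restrict (Set.Ioc (0:ℝ) 1))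
    (f := f) zero_lt_one hp hf.aestronglyMeasurable
  simp only [eLpNorm', enorm_eq_self, ENNReal.rpow_one, div_one] at h
  have h2 := ENNReal.rpow_le_rpow h (by linarith : 0 ≤ p)
  rwa [← ENNReal.rpow_mul, one_div, inv_mul_cancel₀ (by linarith), ENNReal.rpow_one] at h2

lemma aux_gradient_cont {E : Type*} [NormedAddCommGroup E] [InnerProductSpace ℝ E]
    [CompleteSpace E] (v : E → ℝ) (hv : ContDiff ℝ (⊤ : ℕ∞) v) : Continuous (gradient v) := by
  have := hv.continuous_fderiv (by simp)
  exact (InnerProductSpace.toDual ℝ E).symm.continuous.comp this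

lemma aux_main {n : ℕ} (p : ℝ) (hp : 1 ≤ p) (v : EuclideanSpace ℝ (Fin n) → ℝ)
    (hv : ContDiff ℝ (⊤ : ℕ∞) v) (y : EuclideanSpace ℝ (Fin n)) :
    eLpNorm (fun x => v (x + y) - v x) (ENNReal.ofReal p) volume ≤
      ‖y‖ₑ * eLpNorm (fun x => gradient v x) (ENNReal.ofReal p) volume := by
  have hp0 : 0 < p := by linarith
  have hg := aux_gradient_cont v hv
  have e0 : ENNReal.ofReal p ≠ 0 := by simpa using hp0
  rw [eLpNorm_eq_lintegral_rpow_enorm_toReal e0 ENNReal.ofReal_ne_top,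
    eLpNorm_eq_lintegral_rpow_enorm_toReal e0 ENNReal.ofReal_ne_top,
    ENNReal.toReal_ofReal hp0.le]
  have key : ∫⁻ x, ‖v (x + y) - v x‖ₑ ^ p ≤ ‖y‖ₑ ^ p * ∫⁻ x, ‖gradient v x‖ₑ ^ p := by
    calc ∫⁻ x, ‖v (x + y) - v x‖ₑ ^ p
        ≤ ∫⁻ x, ‖y‖ₑ ^ p * ∫⁻ s in Set.Ioc (0:ℝ) 1, ‖gradient v (x + s • y)‖ₑ ^ p := by
          refine lintegral_mono fun x => ?_
          refine (ENNReal.rpow_le_rpow (aux_pointwise v hv x y) hp0.le).trans ?_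
          rw [ENNReal.mul_rpow_of_nonneg _ _ hp0.le]
          gcongr
          refine aux_jensen p hp _ ?_
          have : Continuous (fun s : ℝ => gradient v (x + s • y)) := by fun_prop
          exact this.enorm.measurable
      _ = ‖y‖ₑ ^ p * ∫⁻ s in Set.Ioc (0:ℝ) 1, ∫⁻ x, ‖gradient v (x + s • y)‖ₑ ^ p := by
          rw [lintegral_const_mul' _ _ (ENNReal.rpow_ne_top_of_nonneg hp0.le enorm_ne_top),
            lintegral_lintegral_swap]
          have : Continuous (fun z : EuclideanSpace ℝ (Fin n) × ℝ =>
            gradient v (z.1 + z.2 • y)) := by fun_prop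
          exact (this.enorm.measurable.pow_const p).aemeasurable
      _ = ‖y‖ₑ ^ p * ∫⁻ x, ‖gradient v x‖ₑ ^ p := by
          congr 1
          have : ∀ s : ℝ, ∫⁻ x, ‖gradient v (x + s • y)‖ₑ ^ p = ∫⁻ x, ‖gradient v x‖ₑ ^ p :=
            fun s => lintegral_add_right_eq_self (fun x => ‖gradient v x‖ₑ ^ p) (s • y)
          simp [this]
  refine (ENNReal.rpow_le_rpow key (by positivity)).trans ?_
  rw [ENNReal.mul_rpow_of_nonneg _ _ (by positivity), ← ENNReal.rpow_mul, mul_one_div,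
    div_self hp0.ne', ENNReal.rpow_one]

lemma aux_gradient_supp {E : Type*} [NormedAddCommGroup E] [InnerProductSpace ℝ E]
    [CompleteSpace E] (v : E → ℝ) (hv : HasCompactSupport v) :
    HasCompactSupport (gradient v) := by
  refine (hv.fderiv ℝ).mono fun x hx => ?_
  intro h
  apply hx
  simp [gradient, h]

lemma aux_trans {n : ℕ} (w : EuclideanSpace ℝ (Fin n) → ℝ) (hw : AEStronglyMeasurable w volume)
    (y : EuclideanSpace ℝ (Fin n)) (q : ENNReal) :
    eLpNorm (fun x => w (x + y)) q volume = eLpNorm w q volume := by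
  have hmp : MeasurePreserving (fun x : EuclideanSpace ℝ (Fin n) => x + y) volume volume :=
    measurePreserving_add_right volume y
  have h := eLpNorm_comp_measurePreserving (p := q) hw hmp
  rw [← h]
  rfl

lemma aux_core {n : ℕ} (p : ℝ) (hp : 1 ≤ p) (u v : EuclideanSpace ℝ (Fin n) → ℝ)
    (hu : ContDiff ℝ (⊤ : ℕ∞) u) (hsupp : HasCompactSupport u)
    (hv : ContDiff ℝ (⊤ : ℕ∞) v) (hvs : HasCompactSupport v) (y : EuclideanSpace ℝ (Fin n)) :
    (eLpNorm (fun x => u (x + y) - u x) (ENNReal.ofReal p) volume).toReal ≤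
      (eLpNorm (fun x => u x - v x) (ENNReal.ofReal p) volume).toReal +
      (eLpNorm (fun x => u x - v x) (ENNReal.ofReal p) volume).toReal +
      ‖y‖ * (eLpNorm (fun x => gradient v x) (ENNReal.ofReal p) volume).toReal := by
  have hp1 : 1 ≤ ENNReal.ofReal p := by simpa using hp
  have hw : MemLp (fun x => u x - v x) (ENNReal.ofReal p) volume :=
    (hu.continuous.memLp_of_hasCompactSupport hsupp).sub
      (hv.continuous.memLp_of_hasCompactSupport hvs)
  have hgm : MemLp (gradient v) (ENNReal.ofReal p) volume :=
    (aux_gradient_cont v hv).memLp_of_hasCompactSupport (aux_gradient_supp v hvs)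
  have hmp : MeasurePreserving (fun x : EuclideanSpace ℝ (Fin n) => x + y) volume volume :=
    measurePreserving_add_right volume y
  have hw' : MemLp (fun x => u (x + y) - v (x + y)) (ENNReal.ofReal p) volume :=
    hw.comp_measurePreserving hmp
  have heq : eLpNorm (fun x => u (x + y) - v (x + y)) (ENNReal.ofReal p) volume
      = eLpNorm (fun x => u x - v x) (ENNReal.ofReal p) volume :=
    aux_trans _ hw.1 y _
  have hvm : AEStronglyMeasurable (fun x => v (x + y) - v x) volume := by
    have := hv.continuous
    exact Continuous.aestronglyMeasurable (by fun_prop)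
  have hfun : (fun x => u (x + y) - u x) =
      ((fun x => u (x + y) - v (x + y)) - (fun x => u x - v x)) +
        (fun x => v (x + y) - v x) := by
    funext x
    simp only [Pi.add_apply, Pi.sub_apply]
    ring
  have hE : eLpNorm (fun x => u (x + y) - u x) (ENNReal.ofReal p) volume ≤
      (eLpNorm (fun x => u x - v x) (ENNReal.ofReal p) volume +
        eLpNorm (fun x => u x - v x) (ENNReal.ofReal p) volume) +
      ‖y‖ₑ * eLpNorm (fun x => gradient v x) (ENNReal.ofReal p) volume := by
    rw [hfun]
    refine (eLpNorm_add_le (hw'.1.sub hw.1) hvm hp1).trans ?_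
    refine add_le_add ((eLpNorm_sub_le hw'.1 hw.1 hp1).trans ?_) (aux_main p hp v hv y)
    rw [heq]
  have h1 : eLpNorm (fun x => u x - v x) (ENNReal.ofReal p) volume ≠ ⊤ := hw.2.ne
  have h2 : ‖y‖ₑ * eLpNorm (fun x => gradient v x) (ENNReal.ofReal p) volume ≠ ⊤ :=
    ENNReal.mul_ne_top enorm_ne_top hgm.2.ne
  have hR := ENNReal.toReal_mono (ENNReal.add_ne_top.2 ⟨ENNReal.add_ne_top.2 ⟨h1, h1⟩, h2⟩) hE
  rw [ENNReal.toReal_add (ENNReal.add_ne_top.2 ⟨h1, h1⟩) h2, ENNReal.toReal_add h1 h1,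
    ENNReal.toReal_mul, toReal_enorm] at hR
  exact hR

/-- K-functional estimate for translations:
`min(1,t) ‖u(·+y) − u‖_{L^p} ≤ 2 K̄(t|y|/2, u)` where `K̄` is the K-functional of the
pair `(L^p, Ẇ^{1,p})` computed over smooth compactly supported decompositions. -/
theorem translation_K_functional_bound
    (n : ℕ) (hn : 1 ≤ n) (p : ℝ) (hp : 1 ≤ p)
    (u : EuclideanSpace ℝ (Fin n) → ℝ)
    (hu : ContDiff ℝ (⊤ : ℕ∞) u) (hsupp : HasCompactSupport u) :
    ∀ (y : EuclideanSpace ℝ (Fin n)) (t : ℝ), 0 < t →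
      min 1 t *
          (eLpNorm (fun x => u (x + y) - u x) (ENNReal.ofReal p) volume).toReal ≤
        2 * sInf {r : ℝ | ∃ v : EuclideanSpace ℝ (Fin n) → ℝ,
          ContDiff ℝ (⊤ : ℕ∞) v ∧ HasCompactSupport v ∧
          r = (eLpNorm (fun x => u x - v x) (ENNReal.ofReal p) volume).toReal +
            (t * ‖y‖ / 2) *
              (eLpNorm (fun x => gradient v x) (ENNReal.ofReal p) volume).toReal} := by
  intro y t ht
  rw [← div_le_iff₀' two_pos]
  refine le_csInf ⟨_, u, hu, hsupp, rfl⟩ ?_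
  rintro r ⟨v, hv, hvs, rfl⟩
  have hR := aux_core p hp u v hu hsupp hv hvs y
  set D := (eLpNorm (fun x => u (x + y) - u x) (ENNReal.ofReal p) volume).toReal
  set A := (eLpNorm (fun x => u x - v x) (ENNReal.ofReal p) volume).toReal
  set B := (eLpNorm (fun x => gradient v x) (ENNReal.ofReal p) volume).toReal
  have hA : 0 ≤ A := ENNReal.toReal_nonneg
  have hB : 0 ≤ ‖y‖ * B := mul_nonneg (norm_nonneg _) ENNReal.toReal_nonneg
  have hm : 0 ≤ min 1 t := le_min zero_le_one ht.le
  have q1 := mul_le_mul_of_nonneg_left hR hm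
  have q2 := mul_le_mul_of_nonneg_right (min_le_left 1 t) hA
  have q3 := mul_le_mul_of_nonneg_right (min_le_right 1 t) hB
  linarith
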